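/- Let N be a positive integer, let A be a symmetric N×N real matrix with all row sums positive (∑_k A i k > 0 for every i), and let S₁, ..., S_r be pairwise disjoint finite sets of indices with |S_l| = m_l, such that within each S_l all rows of A coincide (for all i, j ∈ S_l and all k, A i k = A j k), and such that there is a single real number w with ∑_k A i k = w for every i ∈ ⋃_l S_l. Let D = diagonal(fun i => ∑_k A i k), D^{1/2} = diagonal(fun i => Real.sqrt(∑_k A i k)), and let 𝓛 = 1 - (D^{1/2})⁻¹ * A * (D^{1/2})⁻¹ be the normalized Laplacian. Then 1 is an eigenvalue of 𝓛 with multiplicity at least ∑_{l=1}^{r} (m_l - 1); precisely, the eigenspace of 𝓛 for the eigenvalue 1 has dimension at least ∑_{l=1}^{r} (m_l - 1). -/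

import Mathlib

open Matrix

/-- If every row of `A` indexed by `T` coincides with a row not indexed by `T`, then the rows
outside `T` span the row space, so that the rank of `A` is at most `Fintype.card m - #T`. -/
lemma Matrix.card_add_rank_le_of_forall_exists_row_eq {m n K : Type*} [Fintype m] [Fintype n]
    [DecidableEq m] [Field K] (A : Matrix m n K) (T : Finset m)
    (h : ∀ i ∈ T, ∃ j ∉ T, A j = A i) : T.card + A.rank ≤ Fintype.card m := by
  classical
  have hspan : Submodule.span K (Set.range A.row) ≤
      Submodule.span K ((Tᶜ.image A.row : Finset (n → K)) : Set (n → K)) := by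
    refine Submodule.span_mono ?_
    rintro _ ⟨i, rfl⟩
    by_cases hi : i ∈ T
    · obtain ⟨j, hj, hji⟩ := h i hi
      exact Finset.mem_coe.2 (Finset.mem_image.2 ⟨j, Finset.mem_compl.2 hj, hji⟩)
    · exact Finset.mem_coe.2 (Finset.mem_image_of_mem _ (Finset.mem_compl.2 hi))
  have hrank : A.rank ≤ Tᶜ.card := by
    rw [A.rank_eq_finrank_span_row]
    exact ((Submodule.finrank_mono hspan).trans (finrank_span_finset_le_card _)).trans
      Finset.card_image_le
  have := T.card_add_card_compl
  omega

/-- The eigenspace of `1 - B` for the eigenvalue `1` is the kernel of `B`. -/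
lemma Matrix.eigenspace_one_sub_one {n K : Type*} [Fintype n] [DecidableEq n] [Field K]
    (B : Matrix n n K) :
    Module.End.eigenspace (1 - B).mulVecLin (1 : K) = LinearMap.ker B.mulVecLin := by
  ext v
  simp

/-- If a symmetric real matrix `A` with positive row sums has `r` pairwise disjoint
families of coinciding rows (the `l`-th family indexed by a set `S l` of cardinality
`m l`), all with the same row sum `w`, then `1` is an eigenvalue of the normalized
Laplacian `𝓛 = 1 - (D^{1/2})⁻¹ * A * (D^{1/2})⁻¹` of multiplicity at least
`∑ l, (m l - 1)`. -/
theorem normalized_laplacian_eigenvalue_of_hyperstars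
    (N r : ℕ) (hN : 0 < N) (A : Matrix (Fin N) (Fin N) ℝ) (hA : A.IsSymm)
    (hpos : ∀ i, 0 < ∑ k, A i k)
    (S : Fin r → Finset (Fin N)) (m : Fin r → ℕ)
    (hcard : ∀ l, (S l).card = m l)
    (hdisj : ∀ l l', l ≠ l' → Disjoint (S l) (S l'))
    (hrows : ∀ l, ∀ i ∈ S l, ∀ j ∈ S l, ∀ k, A i k = A j k)
    (w : ℝ) (hw : ∀ l, ∀ i ∈ S l, ∑ k, A i k = w) :
    let Dhalf : Matrix (Fin N) (Fin N) ℝ :=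
      Matrix.diagonal (fun i => Real.sqrt (∑ k, A i k))
    let Lnorm : Matrix (Fin N) (Fin N) ℝ := 1 - Dhalf⁻¹ * A * Dhalf⁻¹
    (∑ l, (m l - 1)) ≤
      Module.finrank ℝ (Module.End.eigenspace (Matrix.mulVecLin Lnorm) (1 : ℝ)) := by
  intro Dhalf Lnorm
  have hsub : ∀ l, ∃ t ⊆ S l, t.card = m l - 1 := fun l =>
    Finset.exists_subset_card_eq (by rw [hcard]; exact Nat.sub_le _ _)
  choose t htS htcard using hsub
  have hdisj_t : ∀ l l', l ≠ l' → Disjoint (t l) (t l') := fun l l' hl =>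
    Finset.disjoint_of_subset_left (htS l)
      (Finset.disjoint_of_subset_right (htS l') (hdisj l l' hl))
  have hT : (Finset.univ.biUnion t).card = ∑ l, (m l - 1) := by
    rw [Finset.card_biUnion fun l _ l' _ hl => hdisj_t l l' hl]
    exact Finset.sum_congr rfl fun l _ => htcard l
  have hrep : ∀ i ∈ Finset.univ.biUnion t, ∃ j ∉ Finset.univ.biUnion t, A j = A i := by
    intro i hi
    obtain ⟨l, -, hil⟩ := Finset.mem_biUnion.1 hi
    have hlt : (t l).card < (S l).card := by
      have := Finset.card_pos.2 ⟨i, hil⟩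
      have := htcard l
      have := hcard l
      omega
    obtain ⟨j, hjS, hjt⟩ := Finset.exists_mem_notMem_of_card_lt_card hlt
    refine ⟨j, fun hj => ?_, funext fun k => hrows l j hjS i (htS l hil) k⟩
    obtain ⟨l', -, hjl'⟩ := Finset.mem_biUnion.1 hj
    obtain rfl | hl := eq_or_ne l l'
    · exact hjt hjl'
    · exact Finset.disjoint_left.1 (hdisj l l' hl) hjS (htS l' hjl')
  have hA_rank := A.card_add_rank_le_of_forall_exists_row_eq _ hrep
  have hB_rank : (Dhalf⁻¹ * A * Dhalf⁻¹).rank ≤ A.rank :=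
    (Matrix.rank_mul_le_left _ _).trans (Matrix.rank_mul_le_right _ _)
  have hker := (Dhalf⁻¹ * A * Dhalf⁻¹).mulVecLin.finrank_range_add_finrank_ker
  rw [Module.finrank_fintype_fun_eq_card] at hker
  rw [Matrix.eigenspace_one_sub_one]
  unfold Matrix.rank at hA_rank hB_rank
  omega
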